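/- Fix a Newton diagram datum: an integer n ≥ 1 and lattice points (P₀,Q₀),…,(Pₙ,Qₙ) ∈ ℤ² with P₀ = 0, Qₙ = 0, P₀ < P₁ < … < Pₙ, Q₀ > Q₁ > … > Qₙ, p = Pₙ, q = Q₀, pᵢ = Pᵢ − Pᵢ₋₁, qᵢ = Qᵢ₋₁ − Qᵢ, q₁/p₁ > … > qₙ/pₙ, and gcd(pᵢ,qᵢ) = 1 for each i. Let Γ₋ be the closure of (ℝ≥0)² \ (conv{(P₀,Q₀),…,(Pₙ,Qₙ)} + (ℝ≥0)²), and let v be the number of pairs (i,j) of nonnegative integers with S(i,j) = [i,i+1] × [j,j+1] ⊆ Γ₋. Then 2v = 2·vol(Γ₋) − (p + q) + n, where vol denotes 2-dimensional Lebesgue measure. -/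

import Mathlib

open Set MeasureTheory Pointwise

/-- The unit lattice square `S(i,j) = [i,i+1] × [j,j+1] ⊆ ℝ²`. -/
def unitSq (i j : ℤ) : Set (ℝ × ℝ) :=
  Set.Icc (i : ℝ) (i + 1) ×ˢ Set.Icc (j : ℝ) (j + 1)

/-- The region `Γ₋`: the closure of `(ℝ≥0)² \ (conv{(P₀,Q₀),…,(Pₙ,Qₙ)} + (ℝ≥0)²)`,
where `+` denotes the Minkowski sum. -/
def gammaMinus (n : ℕ) (P Q : ℕ → ℤ) : Set (ℝ × ℝ) :=
  closure ((Set.Ici (0 : ℝ) ×ˢ Set.Ici (0 : ℝ)) \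
    (convexHull ℝ {x : ℝ × ℝ | ∃ i ≤ n, x = ((P i : ℝ), (Q i : ℝ))} +
      Set.Ici (0 : ℝ) ×ˢ Set.Ici (0 : ℝ)))

namespace NDaux

structure ND (n : ℕ) (P Q : ℕ → ℤ) : Prop where
  hn : 1 ≤ n
  hP0 : P 0 = 0
  hQn : Q n = 0
  hP : ∀ i < n, P i < P (i + 1)
  hQ : ∀ i < n, Q (i + 1) < Q i
  hc : ∀ i, i + 1 < n → (Q (i+1) - Q (i+2)) * (P (i+1) - P i) < (Q i - Q (i+1)) * (P (i+2) - P (i+1))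
  hg : ∀ i < n, Int.gcd (P (i+1) - P i) (Q i - Q (i+1)) = 1

/-- The affine function of edge `k`. -/
def L (P Q : ℕ → ℤ) (k : ℕ) (x y : ℝ) : ℝ :=
  ((Q k : ℝ) - Q (k+1)) * (x - P (k+1)) + ((P (k+1) : ℝ) - P k) * (y - Q (k+1))

variable {n : ℕ} {P Q : ℕ → ℤ}

lemma L_eq (k : ℕ) (x y : ℝ) :
    L P Q k x y = ((Q k : ℝ) - Q (k+1)) * (x - P k) + ((P (k+1) : ℝ) - P k) * (y - Q k) := by
  unfold L; ring

lemma ND.Pmono (h : ND n P Q) {i j : ℕ} (hij : i ≤ j) (hj : j ≤ n) : P i ≤ P j := by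
  induction j, hij using Nat.le_induction with
  | base => rfl
  | succ j _ ih => have := h.hP j (by omega); have := ih (by omega); omega

lemma ND.Qanti (h : ND n P Q) {i j : ℕ} (hij : i ≤ j) (hj : j ≤ n) : Q j ≤ Q i := by
  induction j, hij using Nat.le_induction with
  | base => rfl
  | succ j _ ih => have := h.hQ j (by omega); have := ih (by omega); omega

lemma ND.P0 (h : ND n P Q) {i : ℕ} (hi : i ≤ n) : 0 ≤ P i := by
  have := h.Pmono (Nat.zero_le i) hi
  rwa [h.hP0] at this

lemma ND.Q0 (h : ND n P Q) {i : ℕ} (hi : i ≤ n) : 0 ≤ Q i := by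
  have := h.Qanti hi le_rfl
  rwa [h.hQn] at this

lemma ND.pp (h : ND n P Q) {i : ℕ} (hi : i < n) : (0 : ℝ) < (P (i+1) : ℝ) - P i := by
  have := h.hP i hi
  have : (P i : ℝ) < P (i+1) := by exact_mod_cast this
  linarith

lemma ND.qp (h : ND n P Q) {i : ℕ} (hi : i < n) : (0 : ℝ) < (Q i : ℝ) - Q (i+1) := by
  have := h.hQ i hi
  have : (Q (i+1) : ℝ) < Q i := by exact_mod_cast this
  linarith

lemma ND.hc' (h : ND n P Q) {i : ℕ} (hi : i + 1 < n) :
    ((Q (i+1) : ℝ) - Q (i+2)) * (P (i+1) - P i) < (Q i - Q (i+1)) * (P (i+2) - P (i+1)) := by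
  exact_mod_cast h.hc i hi

lemma ND.up1 (h : ND n P Q) {j : ℕ} (hj : j + 1 < n) {x y : ℝ} (hx : (P (j+1) : ℝ) ≤ x) :
    ((P (j+1) : ℝ) - P j) * L P Q (j+1) x y ≤ ((P (j+2) : ℝ) - P (j+1)) * L P Q j x y := by
  rw [L_eq (j+1)]
  have := h.hc' hj
  have := mul_nonneg (sub_nonneg.2 hx) (sub_nonneg.2 this.le)
  unfold L
  nlinarith

lemma ND.down1 (h : ND n P Q) {j : ℕ} (hj : j + 1 < n) {x y : ℝ} (hx : x ≤ P (j+1)) :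
    ((P (j+2) : ℝ) - P (j+1)) * L P Q j x y ≤ ((P (j+1) : ℝ) - P j) * L P Q (j+1) x y := by
  rw [L_eq (j+1)]
  have := h.hc' hj
  have := mul_nonneg (sub_nonneg.2 hx) (sub_nonneg.2 this.le)
  unfold L
  nlinarith

/-- scaled comparison in the strip -/
lemma ND.cmp (h : ND n P Q) {j k : ℕ} (hj : j < n) (hk : k < n) {x y : ℝ}
    (h1 : j < k → (P k : ℝ) ≤ x) (h2 : k < j → x ≤ P (k+1)) :
    ((P (j+1) : ℝ) - P j) * L P Q k x y ≤ ((P (k+1) : ℝ) - P k) * L P Q j x y := by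
  rcases lt_trichotomy j k with hjk | rfl | hjk
  · have hx := h1 hjk
    clear h1 h2
    induction k, hjk using Nat.le_induction with
    | base => exact h.up1 hk hx
    | succ k hjk ih =>
      have hPk : (P k : ℝ) ≤ P (k+1) := by exact_mod_cast h.Pmono (Nat.le_succ k) (by omega)
      have a := ih (by omega) (hPk.trans hx)
      have b := h.up1 hk (y := y) hx
      have c1 := h.pp hj
      have c2 := h.pp (i := k) (by omega)
      have c3 := h.pp hk
      have aa := mul_le_mul_of_nonneg_left a c3.le
      have bb := mul_le_mul_of_nonneg_left b c1.le
      refine le_of_mul_le_mul_left ?_ c2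
      calc _ = _ := by ring
        _ ≤ _ := bb
        _ = _ := by ring
        _ ≤ _ := aa
        _ = _ := by ring
  · rfl
  · have hx := h2 hjk
    clear h1 h2
    induction j, hjk using Nat.le_induction with
    | base => exact h.down1 hj hx
    | succ j hjk ih =>
      have hPk : (P (k+1) : ℝ) ≤ P (j+1) := by exact_mod_cast h.Pmono (by omega) (by omega)
      have a := ih (by omega)
      have b := h.down1 hj (y := y) (hx.trans hPk)
      have c1 := h.pp hk
      have c2 := h.pp (i := j) (by omega)
      have c3 := h.pp hj
      have aa := mul_le_mul_of_nonneg_left a c3.le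
      have bb := mul_le_mul_of_nonneg_left b c1.le
      refine le_of_mul_le_mul_left ?_ c2
      calc _ = _ := by ring
        _ ≤ _ := aa
        _ = _ := by ring
        _ ≤ _ := bb
        _ = _ := by ring

lemma ND.cmp_le (h : ND n P Q) {j k : ℕ} (hj : j < n) (hk : k < n) {x y : ℝ}
    (h1 : j < k → (P k : ℝ) ≤ x) (h2 : k < j → x ≤ P (k+1)) (hL : L P Q j x y ≤ 0) :
    L P Q k x y ≤ 0 := by
  have := h.cmp hj hk (y := y) h1 h2
  have c1 := h.pp hj
  have c2 := h.pp hk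
  by_contra hcon
  push Not at hcon
  nlinarith [mul_pos c1 hcon, mul_nonneg c2.le (neg_nonneg.2 hL)]

lemma ND.vertex (h : ND n P Q) {j i : ℕ} (hj : j < n) (hi : i ≤ n) :
    0 ≤ L P Q j (P i) (Q i) := by
  rcases Nat.lt_or_ge j i with hji | hij
  · obtain ⟨k, rfl⟩ : ∃ k, i = k + 1 := ⟨i - 1, by omega⟩
    have := h.cmp hj (k := k) (by omega) (x := P (k+1)) (y := Q (k+1))
      (fun _ => by exact_mod_cast h.Pmono (Nat.le_succ k) hi) (fun _ => le_rfl)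
    have e : L P Q k (P (k+1)) (Q (k+1)) = 0 := by unfold L; ring
    rw [e, mul_zero] at this
    exact nonneg_of_mul_nonneg_right this (h.pp (i := k) (by omega))
  · have := h.cmp hj (k := i) (by omega) (x := P i) (y := Q i)
      (fun _ => le_rfl) (fun _ => by exact_mod_cast h.Pmono (Nat.le_succ i) (by omega))
    have e : L P Q i (P i) (Q i) = 0 := by rw [L_eq]; ring
    rw [e, mul_zero] at this
    exact nonneg_of_mul_nonneg_right this (h.pp (i := i) (by omega))

lemma ND.strip (h : ND n P Q) {x : ℝ} (hx : 0 < x) {m : ℕ} (hm : x ≤ P m) :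
    ∃ k < m, (P k : ℝ) < x ∧ x ≤ P (k+1) := by
  induction m with
  | zero => rw [h.hP0] at hm; simp at hm; linarith
  | succ m ih =>
    by_cases hc : x ≤ P m
    · obtain ⟨k, hk, hh2⟩ := ih hc
      exact ⟨k, by omega, hh2⟩
    · exact ⟨m, by omega, not_le.1 hc, hm⟩

lemma L_mono (h : ND n P Q) {k : ℕ} (hk : k < n) {x y xx2 yy2 : ℝ} (hx : x ≤ xx2) (hy : y ≤ yy2) :
    L P Q k x y ≤ L P Q k xx2 yy2 := by
  have c1 := h.pp hk
  have c2 := h.qp hk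
  unfold L
  gcongr

lemma mem_newton (h : ND n P Q) (x y : ℝ) :
    (x, y) ∈ convexHull ℝ {x : ℝ × ℝ | ∃ i ≤ n, x = ((P i : ℝ), (Q i : ℝ))} +
      Set.Ici (0 : ℝ) ×ˢ Set.Ici (0 : ℝ) ↔ 0 ≤ x ∧ 0 ≤ y ∧ ∀ k < n, 0 ≤ L P Q k x y := by
  constructor
  · rintro ⟨⟨a, b⟩, hab, ⟨c, d⟩, ⟨hc, hd⟩, e⟩
    simp only [Prod.mk_add_mk, Prod.mk.injEq, mem_Ici] at e hc hd
    obtain ⟨rfl, rfl⟩ := e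
    have key : ∀ u v w : ℝ, (∀ i ≤ n, 0 ≤ u * P i + v * Q i + w) → 0 ≤ u * a + v * b + w := by
      intro u v w huv
      have hcv : Convex ℝ {z : ℝ × ℝ | 0 ≤ u * z.1 + v * z.2 + w} := by
        intro z hz zz2 hzz s t hs ht hst
        simp only [mem_ofPred_eq, Prod.fst_add, Prod.snd_add, Prod.smul_fst, Prod.smul_snd,
          smul_eq_mul] at *
        have : w = s * w + t * w := by rw [← add_mul, hst, one_mul]
        rw [this]
        nlinarith [mul_nonneg hs hz, mul_nonneg ht hzz]
      have := convexHull_min (s := {x : ℝ × ℝ | ∃ i ≤ n, x = ((P i : ℝ), (Q i : ℝ))}) ?_ hcv hab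
      · exact this
      · rintro _ ⟨i, hi, rfl⟩
        exact huv i hi
    have ha : 0 ≤ a := by
      have := key 1 0 0 (fun i hi => by simpa using h.P0 hi)
      simpa using this
    have hb : 0 ≤ b := by
      have := key 0 1 0 (fun i hi => by simpa using h.Q0 hi)
      simpa using this
    refine ⟨by linarith, by linarith, fun k hk => ?_⟩
    have := key ((Q k : ℝ) - Q (k+1)) ((P (k+1) : ℝ) - P k)
      (-((Q k : ℝ) - Q (k+1)) * P (k+1) - ((P (k+1) : ℝ) - P k) * Q (k+1))
      (fun i hi => by have := h.vertex hk hi; unfold L at this; linarith)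
    have h2 : 0 ≤ L P Q k a b := by unfold L; linarith
    exact h2.trans (L_mono h hk (by linarith) (by linarith))
  · rintro ⟨hx, hy, hL⟩
    suffices ∃ a b : ℝ, (a, b) ∈ convexHull ℝ {x : ℝ × ℝ | ∃ i ≤ n, x = ((P i : ℝ), (Q i : ℝ))} ∧
        a ≤ x ∧ b ≤ y by
      obtain ⟨a, b, hab, h1, h2⟩ := this
      exact ⟨(a, b), hab, (x - a, y - b), ⟨by simpa using h1, by simpa using h2⟩, by simp⟩
    have hv : ∀ i ≤ n, ((P i : ℝ), (Q i : ℝ)) ∈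
        convexHull ℝ {x : ℝ × ℝ | ∃ i ≤ n, x = ((P i : ℝ), (Q i : ℝ))} :=
      fun i hi => subset_convexHull ℝ _ ⟨i, hi, rfl⟩
    by_cases hxn : (P n : ℝ) ≤ x
    · exact ⟨P n, Q n, hv n le_rfl, hxn, by rw [h.hQn]; simpa using hy⟩
    rcases hx.eq_or_lt with rfl | hx
    · refine ⟨P 0, Q 0, hv 0 (Nat.zero_le _), by simp [h.hP0], ?_⟩
      have := hL 0 h.hn
      rw [L_eq] at this
      have c := h.pp (i := 0) h.hn
      simp only [h.hP0, Int.cast_zero, sub_zero, mul_zero, zero_add] at this c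
      have := nonneg_of_mul_nonneg_right this c
      linarith
    · obtain ⟨k, hk, h1, h2⟩ := h.strip hx (not_le.1 hxn).le
      have c := h.pp hk
      have hLk := hL k hk
      refine ⟨x, ((P (k+1) : ℝ) - x) / (P (k+1) - P k) * Q k +
        (x - P k) / (P (k+1) - P k) * Q (k+1), ?_, le_rfl, ?_⟩
      · have := convex_convexHull ℝ {x : ℝ × ℝ | ∃ i ≤ n, x = ((P i : ℝ), (Q i : ℝ))}
          (hv k hk.le) (hv (k+1) hk) (a := ((P (k+1) : ℝ) - x) / (P (k+1) - P k))
          (b := (x - P k) / (P (k+1) - P k)) (div_nonneg (by linarith) c.le)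
          (div_nonneg (by linarith) c.le) (by field_simp; ring)
        convert this using 1
        simp only [Prod.smul_mk, smul_eq_mul, Prod.mk_add_mk, Prod.mk.injEq, and_true]
        field_simp
        ring
      · rw [div_mul_eq_mul_div, div_mul_eq_mul_div, ← add_div, div_le_iff₀ c]
        unfold L at hLk
        linarith

lemma L_zero_neg (h : ND n P Q) {k : ℕ} (hk : k < n) : L P Q k 0 0 < 0 := by
  have c1 := h.pp hk
  have c2 := h.qp hk
  have a : (0 : ℝ) ≤ P k := by exact_mod_cast h.P0 hk.le
  have b : (0 : ℝ) ≤ Q (k+1) := by exact_mod_cast h.Q0 hk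
  have a2 : (0 : ℝ) < P (k+1) := by linarith
  unfold L
  nlinarith [mul_pos c2 a2, mul_nonneg c1.le b]

lemma L_cont (k : ℕ) : Continuous fun z : ℝ × ℝ => L P Q k z.1 z.2 := by
  unfold L; fun_prop

lemma mem_gamma (h : ND n P Q) (x y : ℝ) :
    (x, y) ∈ gammaMinus n P Q ↔ 0 ≤ x ∧ 0 ≤ y ∧ ∃ k < n, L P Q k x y ≤ 0 := by
  constructor
  · intro hxy
    have hcl : IsClosed {z : ℝ × ℝ | 0 ≤ z.1 ∧ 0 ≤ z.2 ∧ ∃ k < n, L P Q k z.1 z.2 ≤ 0} := by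
      have : {z : ℝ × ℝ | 0 ≤ z.1 ∧ 0 ≤ z.2 ∧ ∃ k < n, L P Q k z.1 z.2 ≤ 0} =
          {z : ℝ × ℝ | 0 ≤ z.1} ∩ ({z : ℝ × ℝ | 0 ≤ z.2} ∩
            ⋃ k ∈ Finset.range n, {z : ℝ × ℝ | L P Q k z.1 z.2 ≤ 0}) := by
        ext z; simp
      rw [this]
      refine (isClosed_le continuous_const continuous_fst).inter
        ((isClosed_le continuous_const continuous_snd).inter ?_)
      exact isClosed_biUnion_finset fun k _ => isClosed_le (L_cont k) continuous_const
    refine closure_minimal ?_ hcl hxy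
    rintro ⟨a, b⟩ ⟨⟨ha, hb⟩, hnot⟩
    rw [mem_newton h] at hnot
    simp only [mem_Ici] at ha hb
    push Not at hnot
    obtain ⟨k, hk, hL⟩ := hnot ha hb
    exact ⟨ha, hb, k, hk, hL.le⟩
  · rintro ⟨hx, hy, k, hk, hL⟩
    have hlim : Filter.Tendsto (fun t : ℝ => (t * x, t * y)) (nhdsWithin 1 (Set.Iio 1))
        (nhds (x, y)) := by
      have : Filter.Tendsto (fun t : ℝ => (t * x, t * y)) (nhds 1) (nhds (1 * x, 1 * y)) :=
        Continuous.tendsto (by fun_prop) 1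
      rw [one_mul, one_mul] at this
      exact this.mono_left nhdsWithin_le_nhds
    refine mem_closure_of_tendsto hlim ?_
    have : Set.Ioo (0:ℝ) 1 ∈ nhdsWithin (1:ℝ) (Set.Iio 1) := Ioo_mem_nhdsLT one_pos
    filter_upwards [this] with t ht
    refine ⟨⟨mul_nonneg ht.1.le hx, mul_nonneg ht.1.le hy⟩, ?_⟩
    rw [mem_newton h]
    push Not
    refine fun _ _ => ⟨k, hk, ?_⟩
    have e : L P Q k (t * x) (t * y) = t * L P Q k x y + (1 - t) * L P Q k 0 0 := by
      unfold L; ring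
    rw [e]
    have := mul_pos (sub_pos.2 ht.2) (neg_pos.2 (L_zero_neg h hk))
    nlinarith [mul_nonneg ht.1.le (neg_nonneg.2 hL)]

lemma mem_strip (h : ND n P Q) {k : ℕ} (hk : k < n) {x y : ℝ} (h1 : (P k : ℝ) ≤ x)
    (h2 : x ≤ P (k+1)) : (x, y) ∈ gammaMinus n P Q ↔ 0 ≤ y ∧ L P Q k x y ≤ 0 := by
  have h0 : (0 : ℝ) ≤ P k := by exact_mod_cast h.P0 hk.le
  rw [mem_gamma h]
  constructor
  · rintro ⟨_, hy, j, hj, hL⟩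
    exact ⟨hy, h.cmp_le hj hk (fun _ => h1) (fun _ => h2) hL⟩
  · rintro ⟨hy, hL⟩
    exact ⟨h0.trans h1, hy, k, hk, hL⟩

lemma gamma_le (h : ND n P Q) {x y : ℝ} (hm : (x, y) ∈ gammaMinus n P Q) : x ≤ P n := by
  rw [mem_gamma h] at hm
  obtain ⟨_, hy, j, hj, hL⟩ := hm
  by_contra hx
  push Not at hx
  obtain ⟨m, rfl⟩ : ∃ m, n = m + 1 := ⟨n - 1, by have := h.hn; omega⟩
  have h3 : (P m : ℝ) ≤ P (m+1) := by exact_mod_cast h.Pmono (Nat.le_succ m) le_rfl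
  have := h.cmp_le hj (k := m) (by omega) (fun _ => by linarith) (fun _ => by omega) hL
  unfold L at this
  rw [h.hQn] at this
  have c1 := h.pp (i := m) (by omega)
  have c2 := h.qp (i := m) (by omega)
  rw [h.hQn] at c2
  simp only [Int.cast_zero, sub_zero] at this c2
  nlinarith [mul_nonneg c1.le hy, mul_pos c2 (sub_pos.2 hx)]

/-- Upper boundary over strip `k`. -/
noncomputable def ell (P Q : ℕ → ℤ) (k : ℕ) (x : ℝ) : ℝ :=
  Q (k+1) + ((Q k : ℝ) - Q (k+1)) / ((P (k+1) : ℝ) - P k) * (P (k+1) - x)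

lemma L_le_iff (h : ND n P Q) {k : ℕ} (hk : k < n) (x y : ℝ) :
    L P Q k x y ≤ 0 ↔ y ≤ ell P Q k x := by
  have c := h.pp hk
  unfold L ell
  rw [div_mul_eq_mul_div, ← sub_le_iff_le_add', le_div_iff₀ c]
  constructor <;> intro H <;> linarith

def A (P Q : ℕ → ℤ) (k : ℕ) : Set (ℝ × ℝ) :=
  {z | ((P k : ℝ) < z.1 ∧ z.1 ≤ P (k+1)) ∧ (0 ≤ z.2 ∧ z.2 ≤ ell P Q k z.1)}

lemma A_meas (k : ℕ) : MeasurableSet (A P Q k) := by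
  have : Continuous fun z : ℝ × ℝ => ell P Q k z.1 := by unfold ell; fun_prop
  exact (((measurableSet_lt measurable_const measurable_fst)).inter
    (measurableSet_le measurable_fst measurable_const)).inter
    ((measurableSet_le measurable_const measurable_snd).inter
    (measurableSet_le measurable_snd this.measurable))

lemma A_vol (h : ND n P Q) {k : ℕ} (hk : k < n) :
    volume (A P Q k) = ENNReal.ofReal ((P (k+1) - P k) * (Q (k+1) + Q k) / 2) := by
  have c := h.pp hk
  have c2 := h.qp hk
  have hQ : (0 : ℝ) ≤ Q (k+1) := by exact_mod_cast h.Q0 hk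
  have hcont : Continuous (ell P Q k) := by unfold ell; fun_prop
  rw [Measure.volume_eq_prod, Measure.prod_apply (A_meas k)]
  have e : ∀ x, volume (Prod.mk x ⁻¹' A P Q k) =
      (Set.Ioc (P k : ℝ) (P (k+1))).indicator (fun x => ENNReal.ofReal (ell P Q k x)) x := by
    intro x
    by_cases hx : x ∈ Set.Ioc (P k : ℝ) (P (k+1))
    · rw [Set.indicator_of_mem hx]
      have : Prod.mk x ⁻¹' A P Q k = Set.Icc 0 (ell P Q k x) := by
        ext y
        simp only [A, mem_preimage, mem_ofPred_eq, mem_Icc]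
        exact ⟨fun H => H.2, fun H => ⟨hx, H⟩⟩
      rw [this, Real.volume_Icc, sub_zero]
    · rw [Set.indicator_of_notMem hx]
      have : Prod.mk x ⁻¹' A P Q k = ∅ := by
        ext y
        simp only [A, mem_preimage, mem_ofPred_eq, mem_empty_iff_false, iff_false]
        exact fun H => hx H.1
      rw [this, measure_empty]
  simp_rw [e]
  rw [lintegral_indicator measurableSet_Ioc, ← ofReal_integral_eq_lintegral_ofReal]
  · congr 1
    rw [← intervalIntegral.integral_of_le (by linarith)]
    unfold ell
    rw [intervalIntegral.integral_add (by simp) (Continuous.intervalIntegrable (by fun_prop) _ _)]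
    rw [intervalIntegral.integral_const_mul, intervalIntegral.integral_sub (by simp) (by simp)]
    simp only [intervalIntegral.integral_const, integral_id, smul_eq_mul]
    field_simp
    ring
  · exact (hcont.integrableOn_Icc (a := (P k : ℝ)) (b := P (k+1))).mono_set Set.Ioc_subset_Icc_self
  · refine (ae_restrict_iff' measurableSet_Ioc).2 (Filter.Eventually.of_forall fun x hx => ?_)
    have := hx.2
    unfold ell
    exact add_nonneg hQ (mul_nonneg (div_nonneg c2.le c.le) (by linarith))

lemma gamma_vol (h : ND n P Q) :
    (volume (gammaMinus n P Q)).toReal =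
      ∑ k ∈ Finset.range n, ((P (k+1) : ℝ) - P k) * (Q (k+1) + Q k) / 2 := by
  have hsub : (⋃ k ∈ Finset.range n, A P Q k) ⊆ gammaMinus n P Q := by
    intro z hz
    simp only [mem_iUnion, Finset.mem_range] at hz
    obtain ⟨k, hk, hz1, hz2⟩ := hz
    exact (mem_strip h hk hz1.1.le hz1.2).2 ⟨hz2.1, (L_le_iff h hk _ _).2 hz2.2⟩
  have hsup : gammaMinus n P Q ⊆ (⋃ k ∈ Finset.range n, A P Q k) ∪ ({0} ×ˢ Set.univ) := by
    rintro ⟨x, y⟩ hz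
    have hx := ((mem_gamma h x y).1 hz).1
    rcases hx.eq_or_lt with rfl | hx
    · right; simp
    · left
      obtain ⟨k, hk, h1, h2⟩ := h.strip hx (gamma_le h hz)
      have := (mem_strip h hk h1.le h2).1 hz
      simp only [mem_iUnion, Finset.mem_range]
      exact ⟨k, hk, ⟨h1, h2⟩, this.1, (L_le_iff h hk _ _).1 this.2⟩
  have hnull : volume (({0} : Set ℝ) ×ˢ (Set.univ : Set ℝ)) = 0 := by
    rw [Measure.volume_eq_prod, Measure.prod_prod]; simp
  have e : volume (gammaMinus n P Q) = volume (⋃ k ∈ Finset.range n, A P Q k) := by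
    refine le_antisymm ((measure_mono hsup).trans ((measure_union_le _ _).trans ?_))
      (measure_mono hsub)
    rw [hnull, add_zero]
  have hpos : ∀ k ∈ Finset.range n, (0:ℝ) ≤ ((P (k+1) : ℝ) - P k) * (Q (k+1) + Q k) / 2 := by
    intro k hk
    have hk := Finset.mem_range.1 hk
    have c := h.pp hk
    have a : (0 : ℝ) ≤ Q (k+1) := by exact_mod_cast h.Q0 hk
    have b : (0 : ℝ) ≤ Q k := by exact_mod_cast h.Q0 hk.le
    positivity
  rw [e, measure_biUnion_finset, Finset.sum_congr rfl
    (fun k hk => A_vol h (Finset.mem_range.1 hk)), ← ENNReal.ofReal_sum_of_nonneg hpos,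
    ENNReal.toReal_ofReal (Finset.sum_nonneg hpos)]
  · intro i hi j hj hij
    have aux : ∀ i j, j < n → i < j → Disjoint (A P Q i) (A P Q j) := by
      intro i j hj hij
      rw [Set.disjoint_left]
      rintro z ⟨⟨_, h1⟩, _⟩ ⟨⟨h2, _⟩, _⟩
      have : (P (i+1) : ℝ) ≤ P j := by exact_mod_cast h.Pmono hij hj.le
      linarith
    simp only [Finset.coe_range, mem_Iio] at hi hj
    rcases lt_or_gt_of_ne hij with hlt | hlt
    · exact aux i j hj hlt
    · exact (aux j i hi hlt).symm
  · exact fun k _ => A_meas k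

lemma unitSq_iff (h : ND n P Q) (i j : ℕ) :
    unitSq i j ⊆ gammaMinus n P Q ↔ ((i : ℝ) + 1, (j : ℝ) + 1) ∈ gammaMinus n P Q := by
  constructor
  · intro H
    apply H
    simp [unitSq]
  · rintro H ⟨x, y⟩ ⟨hx, hy⟩
    rw [mem_gamma h] at H ⊢
    obtain ⟨_, _, k, hk, hL⟩ := H
    simp only [mem_Icc, Int.cast_natCast] at hx hy
    exact ⟨(Nat.cast_nonneg i).trans hx.1, (Nat.cast_nonneg j).trans hy.1, k, hk,
      (L_mono h hk hx.2 hy.2).trans hL⟩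

lemma sum_floor (p q : ℤ) (m : ℕ) (hp : p = m + 1) (hg : Int.gcd p q = 1) :
    2 * ∑ t ∈ Finset.range (m+1), (q * t) / p = (p - 1) * (q - 1) := by
  have hp0 : 0 < p := by omega
  rw [Finset.sum_range_succ']
  simp only [Nat.cast_zero, mul_zero, Int.zero_ediv, add_zero]
  rw [two_mul]
  nth_rewrite 2 [← Finset.sum_range_reflect]
  rw [← Finset.sum_add_distrib]
  have : ∀ t ∈ Finset.range m, q * ((t + 1 : ℕ) : ℤ) / p + q * ((m - 1 - t + 1 : ℕ) : ℤ) / p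
      = q - 1 := by
    intro t ht
    have ht := Finset.mem_range.1 ht
    have e : ((m - 1 - t + 1 : ℕ) : ℤ) = p - ((t + 1 : ℕ) : ℤ) := by omega
    rw [e]
    set s : ℤ := ((t + 1 : ℕ) : ℤ) with hs
    have hs1 : 0 < s ∧ s < p := by omega
    have hnd : ¬ p ∣ q * s := by
      intro hd
      have := Int.dvd_of_dvd_mul_right_of_gcd_one hd hg
      have := Int.le_of_dvd hs1.1 this
      omega
    have hr : 0 < q * s % p := by
      have := Int.emod_nonneg (q * s) hp0.ne'
      rcases this.eq_or_lt with h0 | h0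
      · exact absurd (Int.dvd_of_emod_eq_zero h0.symm) hnd
      · exact h0
    have hr2 := Int.emod_lt_of_pos (q * s) hp0
    have hdm := Int.mul_ediv_add_emod (q * s) p
    have : q * (p - s) / p = q - 1 - q * s / p := by
      rw [Int.ediv_eq_iff_of_pos hp0]
      constructor <;> nlinarith
    rw [this]; ring
  rw [Finset.sum_congr rfl this]
  simp [hp]
  ring

/-- lattice points of strip `k` -/
noncomputable def B (P Q : ℕ → ℤ) (k : ℕ) : Finset (ℕ × ℕ) :=
  ((Finset.range (P (k+1) - P k).toNat).sigma
    (fun t => Finset.range (Q (k+1) + (Q k - Q (k+1)) * t / (P (k+1) - P k)).toNat)).image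
    (fun z => ((P (k+1)).toNat - 1 - z.1, z.2))

lemma B_card (h : ND n P Q) {k : ℕ} (hk : k < n) :
    2 * ((B P Q k).card : ℤ) = (P (k+1) - P k) * (Q (k+1) + Q k)
      - (P (k+1) - P k) - (Q k - Q (k+1)) + 1 := by
  have hp := h.hP k hk
  have hq := h.hQ k hk
  have hP := h.P0 hk.le
  have hQ := h.Q0 (i := k+1) hk
  obtain ⟨m, hm⟩ : ∃ m : ℕ, P (k+1) - P k = m + 1 := ⟨(P (k+1) - P k - 1).toNat, by omega⟩
  unfold B
  rw [Finset.card_image_of_injOn, Finset.card_sigma]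
  · simp only [Finset.card_range]
    have hm' : (P (k+1) - P k).toNat = m + 1 := by omega
    rw [hm']
    push_cast
    have : ∀ t ∈ Finset.range (m+1),
        max (Q (k+1) + (Q k - Q (k+1)) * (t:ℤ) / (P (k+1) - P k)) 0
          = Q (k+1) + (Q k - Q (k+1)) * (t:ℤ) / (P (k+1) - P k) := by
      intro t _
      apply max_eq_left
      have : 0 ≤ (Q k - Q (k+1)) * (t:ℤ) / (P (k+1) - P k) :=
        Int.ediv_nonneg (mul_nonneg (by omega) (by omega)) (by omega)
      omega
    simp only [Int.ofNat_toNat]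
    rw [Finset.sum_congr rfl this, Finset.sum_add_distrib, mul_add,
      sum_floor _ _ m hm (h.hg k hk)]
    simp only [Finset.sum_const, Finset.card_range, nsmul_eq_mul]
    push_cast
    rw [← hm]
    ring
  · rintro ⟨t, j⟩ hz ⟨tt2, jj2⟩ hzz e
    simp only [Finset.coe_sigma, Finset.coe_range, Set.mem_sigma_iff, mem_Iio, Prod.mk.injEq] at hz hzz e
    obtain ⟨e1, rfl⟩ := e
    have : t = tt2 := by omega
    subst this
    rfl

lemma mem_B (h : ND n P Q) {k : ℕ} (hk : k < n) (i j : ℕ) :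
    (i, j) ∈ B P Q k ↔ (P k < i + 1 ∧ (i : ℤ) + 1 ≤ P (k+1)) ∧
      L P Q k ((i : ℝ) + 1) ((j : ℝ) + 1) ≤ 0 := by
  have hp := h.hP k hk
  have hP := h.P0 hk.le
  have hQ := h.Q0 (i := k+1) hk
  have hp0 : 0 < P (k+1) - P k := by omega
  have key : ∀ t : ℤ, P (k+1) = i + 1 + t →
      (L P Q k ((i : ℝ) + 1) ((j : ℝ) + 1) ≤ 0 ↔
        (j : ℤ) < Q (k+1) + (Q k - Q (k+1)) * t / (P (k+1) - P k)) := by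
    intro t ht
    have : L P Q k ((i : ℝ) + 1) ((j : ℝ) + 1) =
        (((Q k - Q (k+1)) * ((i + 1) - P (k+1)) + (P (k+1) - P k) * (j + 1 - Q (k+1)) : ℤ) : ℝ) := by
      unfold L; push_cast; ring
    rw [this]
    have e2 : (j : ℤ) < Q (k+1) + (Q k - Q (k+1)) * t / (P (k+1) - P k) ↔
        (j : ℤ) + 1 - Q (k+1) ≤ (Q k - Q (k+1)) * t / (P (k+1) - P k) := by
      constructor <;> intro <;> omega
    rw [e2, Int.le_ediv_iff_mul_le hp0, Int.cast_nonpos]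
    have : (i : ℤ) + 1 - P (k+1) = -t := by omega
    rw [this]
    constructor <;> intro H <;> linarith
  unfold B
  simp only [Finset.mem_image, Finset.mem_sigma, Finset.mem_range, Prod.mk.injEq, Sigma.exists]
  constructor
  · rintro ⟨t, jj2, ⟨h1, h2⟩, h3, rfl⟩
    refine ⟨by omega, (key t (by omega)).2 (by omega)⟩
  · rintro ⟨h1, h2⟩
    refine ⟨(P (k+1) - i - 1).toNat, j, ⟨by omega, ?_⟩, by omega, rfl⟩
    have e : (((P (k+1) - i - 1).toNat : ℕ) : ℤ) = P (k+1) - i - 1 := by omega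
    rw [e]
    have := (key (P (k+1) - i - 1) (by omega)).1 h2
    omega

lemma count (h : ND n P Q) :
    {ij : ℕ × ℕ | unitSq ij.1 ij.2 ⊆ gammaMinus n P Q}.ncard =
      ∑ k ∈ Finset.range n, (B P Q k).card := by
  have e : {ij : ℕ × ℕ | unitSq ij.1 ij.2 ⊆ gammaMinus n P Q} =
      ((Finset.range n).biUnion (B P Q) : Finset (ℕ × ℕ)) := by
    ext ⟨i, j⟩
    simp only [mem_ofPred_eq, Finset.coe_biUnion, Finset.coe_range, mem_Iio, mem_iUnion,
      Finset.mem_coe, exists_prop]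
    rw [unitSq_iff h]
    have hi : (0 : ℝ) < (i : ℝ) + 1 := by positivity
    constructor
    · intro H
      obtain ⟨k, hk, h1, h2⟩ := h.strip hi (gamma_le h H)
      refine ⟨k, hk, (mem_B h hk i j).2 ⟨⟨by exact_mod_cast h1, by exact_mod_cast h2⟩,
        ((mem_strip h hk h1.le h2).1 H).2⟩⟩
    · rintro ⟨k, hk, H⟩
      obtain ⟨⟨h1, h2⟩, H⟩ := (mem_B h hk i j).1 H
      have h1 : (P k : ℝ) < (i : ℝ) + 1 := by exact_mod_cast h1
      have h2 : (i : ℝ) + 1 ≤ P (k+1) := by exact_mod_cast h2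
      exact (mem_strip h hk h1.le h2).2 ⟨by positivity, H⟩
  rw [e, Set.ncard_coe_finset, Finset.card_biUnion]
  have aux : ∀ i j, i < n → j < n → i < j → Disjoint (B P Q i) (B P Q j) := by
    intro i j hi hj hij
    rw [Finset.disjoint_left]
    rintro ⟨a, b⟩ h1 h2
    have h1 := ((mem_B h hi a b).1 h1).1
    have h2 := ((mem_B h hj a b).1 h2).1
    have := h.Pmono hij hj.le
    simp only [Nat.succ_eq_add_one] at this
    omega
  intro i hi j hj hij
  have hi := Finset.mem_range.1 hi
  have hj := Finset.mem_range.1 hj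
  rcases lt_or_gt_of_ne hij with hlt | hlt
  · exact aux i j hi hj hlt
  · exact (aux j i hj hi hlt).symm

lemma main (h : ND n P Q) :
    2 * ({ij : ℕ × ℕ | unitSq ij.1 ij.2 ⊆ gammaMinus n P Q}.ncard : ℝ) =
      2 * (volume (gammaMinus n P Q)).toReal -
        (((P n : ℤ) : ℝ) + ((Q 0 : ℤ) : ℝ)) + n := by
  rw [count h, gamma_vol h]
  push_cast
  rw [Finset.mul_sum, Finset.mul_sum]
  have e : ∀ k ∈ Finset.range n, 2 * ((B P Q k).card : ℝ) =
      2 * (((P (k+1) : ℝ) - P k) * (Q (k+1) + Q k) / 2) - ((P (k+1) : ℝ) - P k)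
        + ((Q (k+1) : ℝ) - Q k) + 1 := by
    intro k hk
    have := B_card h (Finset.mem_range.1 hk)
    have : 2 * ((B P Q k).card : ℝ) = (P (k+1) - P k) * (Q (k+1) + Q k)
      - (P (k+1) - P k) - (Q k - Q (k+1)) + 1 := by exact_mod_cast this
    rw [this]; ring
  rw [Finset.sum_congr rfl e, Finset.sum_add_distrib, Finset.sum_add_distrib,
    Finset.sum_sub_distrib, Finset.sum_range_sub (fun k => (P k : ℝ)),
    Finset.sum_range_sub (fun k => (Q k : ℝ)), h.hP0, h.hQn]
  simp
  ring

end NDaux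

/-- For a Newton diagram datum with `gcd(pᵢ,qᵢ) = 1`, with `p = Pₙ`, `q = Q₀`, and `v`
the number of unit lattice squares with nonnegative-integer corner contained in `Γ₋`:
`2v = 2·vol(Γ₋) - (p + q) + n`. (This is the combinatorial content of Corollary 3.6:
`δ(f) = v(T_F|_{Γ₋(f)})`.) -/
theorem two_delta_eq_two_v (n : ℕ) (hn : 1 ≤ n) (P Q : ℕ → ℤ)
    (hP0 : P 0 = 0) (hQn : Q n = 0)
    (hPmono : ∀ i < n, P i < P (i + 1))
    (hQmono : ∀ i < n, Q (i + 1) < Q i)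
    (hconv : ∀ i, 1 ≤ i → i < n →
      ((Q (i - 1) - Q i : ℤ) : ℚ) / ((P i - P (i - 1) : ℤ) : ℚ) >
        ((Q i - Q (i + 1) : ℤ) : ℚ) / ((P (i + 1) - P i : ℤ) : ℚ))
    (hgcd : ∀ i, 1 ≤ i → i ≤ n → Int.gcd (P i - P (i - 1)) (Q (i - 1) - Q i) = 1) :
    2 * ({ij : ℕ × ℕ | unitSq ij.1 ij.2 ⊆ gammaMinus n P Q}.ncard : ℝ) =
      2 * (volume (gammaMinus n P Q)).toReal -
        (((P n : ℤ) : ℝ) + ((Q 0 : ℤ) : ℝ)) + n := by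


  refine NDaux.main ⟨hn, hP0, hQn, hPmono, hQmono, ?_, ?_⟩
  · intro i hi
    have := hconv (i+1) (by omega) hi
    have a := hPmono i (by omega)
    have b := hPmono (i+1) hi
    simp only [Nat.add_sub_cancel] at this
    have aa : (0 : ℚ) < ((P (i+1) - P i : ℤ) : ℚ) := by exact_mod_cast sub_pos.2 a
    have bb : (0 : ℚ) < ((P (i+1+1) - P (i+1) : ℤ) : ℚ) := by exact_mod_cast sub_pos.2 b
    rw [gt_iff_lt, div_lt_div_iff₀ bb aa] at this
    exact_mod_cast this
  · intro i hi
    exact hgcd (i+1) (by omega) hi
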